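/- Let A ⊆ A_m^n be a braid-type arrangement. The map Λ : L(A) → P(A) defined by Λ(L) = (blocks(L), δ_L) is a bijection from the intersection lattice L(A) onto P(A), and its inverse is the map Δ : P(A) → L(A) defined by Δ({B_1,…,B_d}, δ) = ⋂_{k=1}^d ⋂_{(i,j,s) ∈ Tr_m^n(A), i,j ∈ B_k, s = δ(i)−δ(j)} {x_i − x_j = s}. -/

import Mathlib

open scoped BigOperators Classical

namespace Braid

/-- The hyperplane `{x ∈ ℝ^n | x i - x j = s}`. -/
def hyp (n : ℕ) (i j : Fin n) (s : ℝ) : Set (Fin n → ℝ) := {x | x i - x j = s}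

/-- The arrangement `A_S^n`, as a set of hyperplanes. -/
def arrS (S : Set ℤ) (n : ℕ) : Set (Set (Fin n → ℝ)) :=
  {H | ∃ i j : Fin n, ∃ s : ℤ, i < j ∧ s ∈ S ∧ H = hyp n i j (s : ℝ)}

/-- The `m`-Catalan arrangement `A_m^n = A_{[-m;m]}^n`. -/
def catArr (m n : ℕ) : Set (Set (Fin n → ℝ)) := arrS {s : ℤ | s.natAbs ≤ m} n

/-- `(i,j,s) ∈ Tr_m^n`. -/
def TrIdx (m n : ℕ) (i j : Fin n) (s : ℕ) : Prop := s ≤ m ∧ i ≠ j ∧ (0 < s ∨ j < i)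

/-- `(i,j,s) ∈ Tr_m^n(A)`. -/
def TrIdxA (m n : ℕ) (A : Set (Set (Fin n → ℝ))) (i j : Fin n) (s : ℕ) : Prop :=
  TrIdx m n i j s ∧ hyp n i j (s : ℝ) ∈ A

/-- A transitive arrangement `A ⊆ A_m^n`. -/
def IsTransitive (m n : ℕ) (A : Set (Set (Fin n → ℝ))) : Prop :=
  ∀ i j k : Fin n, i ≠ j → j ≠ k → i ≠ k → ∀ s t : ℕ,
    TrIdx m n i j s → TrIdx m n j k t →
    hyp n i j (s : ℝ) ∉ A → hyp n j k (t : ℝ) ∉ A → hyp n i k ((s : ℝ) + (t : ℝ)) ∉ A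

/-- A strongly transitive arrangement. -/
def IsStronglyTransitive (n : ℕ) (A : Set (Set (Fin n → ℝ))) : Prop :=
  ∀ i j k : Fin n, i ≠ j → j ≠ k → i ≠ k → ∀ s t : ℕ,
    hyp n i j (s : ℝ) ∉ A → hyp n j k (t : ℝ) ∉ A → hyp n i k ((s : ℝ) + (t : ℝ)) ∉ A

/-- An `(m,n)`-tree: a rooted `(m+1)`-ary tree with `n` nodes labeled by `Fin n`
(leaves unlabeled), encoded by the root-to-node lists of child indices. -/
structure Tree (m n : ℕ) where
  path : Fin n → List ℕ
  entry_le : ∀ v : Fin n, ∀ s ∈ path v, s ≤ m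
  inj : Function.Injective path
  parent_closed : ∀ v : Fin n, path v ≠ [] → ∃ w : Fin n, path w = (path v).dropLast

namespace Tree

variable {m n : ℕ}

/-- The drift of a node. -/
def drift (T : Tree m n) (v : Fin n) : ℕ := (T.path v).sum

/-- `i = s`-child`(j)`. -/
def IsChild (T : Tree m n) (i j : Fin n) (s : ℕ) : Prop := T.path i = T.path j ++ [s]

/-- The `s`-child slot of node `j` is occupied by a node (not a leaf). -/
def SlotNode (T : Tree m n) (j : Fin n) (s : ℕ) : Prop := ∃ i, T.IsChild i j s

/-- `i = s`-cadet`(j)`. -/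
def IsCadet (T : Tree m n) (i j : Fin n) (s : ℕ) : Prop :=
  T.IsChild i j s ∧ ∀ t : ℕ, s < t → t ≤ m → ¬ T.SlotNode j t

end Tree

/-- The order `≺_T` on vertices of a tree, expressed on root-to-vertex paths:
`v ≺_T w` iff `drift(v) < drift(w)`, or the drifts are equal and there is `c ≤ k`
(`k` the length of the path of `v`) with the first `c` entries of both paths equal and
(`c = k` or the entry of the path of `v` at position `c+1` is larger than that of `w`). -/
def vlt (p q : List ℕ) : Prop :=
  p.sum < q.sum ∨
    (p.sum = q.sum ∧ ∃ c ≤ p.length, p.take c = q.take c ∧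
      (c = p.length ∨ ∃ (h1 : c < p.length) (h2 : c < q.length), q.get ⟨c, h2⟩ < p.get ⟨c, h1⟩))

/-- `p ≽_T q`. -/
def vge (p q : List ℕ) : Prop := vlt q p ∨ p = q

/-- A valid marking: `μ` is the set of (lower endpoints of) marked edges; each marked
edge is a cadet edge, and marked `0`-cadet edges `{j, 0cadet(j)}` satisfy `j < 0cadet(j)`. -/
def IsMarking {m n : ℕ} (T : Tree m n) (μ : Set (Fin n)) : Prop :=
  ∀ i ∈ μ, ∃ j s, T.IsCadet i j s ∧ (s = 0 → (j : ℕ) < (i : ℕ))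

/-- The relation `i ∼_μ j`: all edges on the tree path between `i` and `j` are marked. -/
def simMu {m n : ℕ} (T : Tree m n) (μ : Set (Fin n)) : Fin n → Fin n → Prop :=
  Relation.ReflTransGen (fun a b =>
    (a ∈ μ ∧ ∃ s, T.IsChild a b s) ∨ (b ∈ μ ∧ ∃ s, T.IsChild b a s))

/-- The block containing node `i`. -/
def blockOf {m n : ℕ} (T : Tree m n) (μ : Set (Fin n)) (i : Fin n) : Set (Fin n) :=
  {j | simMu T μ i j}

/-- The set of blocks of a marked tree. -/
def blocksOf {m n : ℕ} (T : Tree m n) (μ : Set (Fin n)) : Set (Set (Fin n)) :=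
  {B | ∃ i, B = blockOf T μ i}

/-- The block `B` is `A`-connected. -/
def BlockConnected {m n : ℕ} (A : Set (Set (Fin n → ℝ))) (T : Tree m n)
    (B : Set (Fin n)) : Prop :=
  ∀ i ∈ B, ∀ j ∈ B, Relation.ReflTransGen
    (fun a b => a ∈ B ∧ b ∈ B ∧ hyp n a b ((T.drift a : ℝ) - (T.drift b : ℝ)) ∈ A) i j

/-- The marked tree `(T,μ)` is `A`-connected. -/
def AConnected {m n : ℕ} (A : Set (Set (Fin n → ℝ))) (T : Tree m n)
    (μ : Set (Fin n)) : Prop :=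
  ∀ B ∈ blocksOf T μ, BlockConnected A T B

/-- The `A`-cadet condition. -/
def CadetCond {m n : ℕ} (A : Set (Set (Fin n → ℝ))) (T : Tree m n)
    (μ : Set (Fin n)) : Prop :=
  ∀ i j s, T.IsCadet i j s → i ∉ μ →
    ((s = 0 ∧ (i : ℕ) < (j : ℕ)) ∨
      ∃ i' j', simMu T μ i i' ∧ simMu T μ j j' ∧
        hyp n i' j' ((T.drift i' : ℝ) - (T.drift j' : ℝ)) ∈ A)

/-- The set `ŌT_m^n` of all marked `(m,n)`-trees. -/
def OTall (m n : ℕ) : Set (Tree m n × Set (Fin n)) := {p | IsMarking p.1 p.2}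

/-- The set `ŌT_m^n(A)`. -/
def OTset (m n : ℕ) (A : Set (Set (Fin n → ℝ))) : Set (Tree m n × Set (Fin n)) :=
  {p | IsMarking p.1 p.2 ∧ AConnected A p.1 p.2 ∧ CadetCond A p.1 p.2}

/-- The set `T_m^n(A)` of (unmarked) trees. -/
def Tset (m n : ℕ) (A : Set (Set (Fin n → ℝ))) : Set (Tree m n) :=
  {T | ∀ i j s, TrIdx m n i j s → hyp n i j (s : ℝ) ∉ A → ¬ T.IsCadet i j s}

/-- The region `Φ_A(T)`. -/
def Phi (m n : ℕ) (A : Set (Set (Fin n → ℝ))) (T : Tree m n) : Set (Fin n → ℝ) :=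
  {x | ∀ i j : Fin n, ∀ s : ℕ, TrIdxA m n A i j s →
        (vlt (T.path i) (T.path j ++ [s]) → x i - x j < (s : ℝ)) ∧
        (vge (T.path i) (T.path j ++ [s]) → (s : ℝ) < x i - x j)}

/-- The polyhedron `Φ̄_A(T,μ)`. -/
def PhiBar (m n : ℕ) (A : Set (Set (Fin n → ℝ))) (T : Tree m n) (μ : Set (Fin n)) :
    Set (Fin n → ℝ) :=
  {x | (∀ i ∈ μ, ∀ j s, T.IsChild i j s → x i - x j = (s : ℝ)) ∧
       ∀ i j : Fin n, ∀ s : ℕ, TrIdxA m n A i j s → ¬ simMu T μ i j →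
         (vlt (T.path i) (T.path j ++ [s]) → x i - x j < (s : ℝ)) ∧
         (vge (T.path i) (T.path j ++ [s]) → (s : ℝ) < x i - x j)}

/-- `R` is a region of `A`: a connected component of the complement of the union of `A`. -/
def IsRegion (n : ℕ) (A : Set (Set (Fin n → ℝ))) (R : Set (Fin n → ℝ)) : Prop :=
  ∃ x ∈ (⋃₀ A)ᶜ, R = connectedComponentIn (⋃₀ A)ᶜ x

/-- `σ` is the hyperplane `H` itself or one of the two open half-spaces bounded by `H`. -/
def IsSideOf (n : ℕ) (σ H : Set (Fin n → ℝ)) : Prop :=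
  σ = H ∨ ∃ (i j : Fin n) (s : ℝ), H = hyp n i j s ∧
    (σ = {x | x i - x j < s} ∨ σ = {x | s < x i - x j})

/-- `F` is a face of the arrangement `A`. -/
def IsFace (n : ℕ) (A : Set (Set (Fin n → ℝ))) (F : Set (Fin n → ℝ)) : Prop :=
  F.Nonempty ∧ ∃ σ : Set (Fin n → ℝ) → Set (Fin n → ℝ),
    (∀ H ∈ A, IsSideOf n (σ H) H) ∧ F = ⋂ H ∈ A, σ H

/-- The dimension of (the affine hull of) a subset of `ℝ^n`. -/
noncomputable def faceDim (n : ℕ) (F : Set (Fin n → ℝ)) : ℕ :=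
  Module.finrank ℝ (affineSpan ℝ F).direction

/-- The intersection lattice `L(A)`: nonempty intersections of subfamilies of `A`
(including `ℝ^n` as the empty intersection). -/
def latt (n : ℕ) (A : Set (Set (Fin n → ℝ))) : Set (Set (Fin n → ℝ)) :=
  {L | L.Nonempty ∧ ∃ B ⊆ A, L = ⋂₀ B}

/-- `i ∼_L j`: `L` is contained in a hyperplane `{x_i - x_j = s}` for some `s ∈ ℤ`. -/
def simL (n : ℕ) (L : Set (Fin n → ℝ)) (i j : Fin n) : Prop :=
  ∃ s : ℤ, L ⊆ hyp n i j (s : ℝ)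

/-- The set `blocks(L)` of equivalence classes of `∼_L`. -/
def blocksL (n : ℕ) (L : Set (Fin n → ℝ)) : Set (Set (Fin n)) :=
  {C | ∃ i, C = {j | simL n L i j}}

/-- `i ≼_L j` (within a block of `L`): `x_i < x_j` on `L`, or `x_i = x_j` on `L`
and `i ≤ j`. -/
def precLE (n : ℕ) (L : Set (Fin n → ℝ)) (i j : Fin n) : Prop :=
  (∀ x ∈ L, x i < x j) ∨ ((∀ x ∈ L, x i = x j) ∧ i ≤ j)

/-- The arrangement `Ã_L ⊆ ℝ^d` (given the enumeration `B` of the blocks of `L` and the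
function `δ = δ_L`). -/
def Atilde (n d : ℕ) (A : Set (Set (Fin n → ℝ))) (B : Fin d → Set (Fin n))
    (δ : Fin n → ℕ) : Set (Set (Fin d → ℝ)) :=
  {H | ∃ k l : Fin d, k ≠ l ∧ ∃ i ∈ B k, ∃ j ∈ B l, ∃ s : ℤ,
    hyp n i j (s : ℝ) ∈ A ∧ H = hyp d k l ((s : ℝ) - (δ i : ℝ) + (δ j : ℝ))}
/-- The function `δ_L : [n] → ℕ`: `δ_L(i)` is the constant value on `L` of `x_i - x_{a}`,
where `a` is the `≼_L`-minimal element of the block of `i`; equivalently, the largest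
`c ∈ ℕ` such that `L ⊆ {x_i - x_j = c}` for some `j`. -/
noncomputable def deltaL (n : ℕ) (L : Set (Fin n → ℝ)) (i : Fin n) : ℕ :=
  sSup {c : ℕ | ∃ j : Fin n, L ⊆ hyp n i j (c : ℝ)}

/-- `(B, δ)` is `A`-connected. -/
def PairConnected (n : ℕ) (A : Set (Set (Fin n → ℝ))) (B : Set (Fin n))
    (δ : Fin n → ℕ) : Prop :=
  ∀ i ∈ B, ∀ j ∈ B, Relation.ReflTransGen
    (fun u v => u ∈ B ∧ v ∈ B ∧ hyp n u v ((δ u : ℝ) - (δ v : ℝ)) ∈ A) i j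

/-- The set `P(A)` of pairs `({B_1,…,B_d}, δ)` where the `B_k` form a set partition of
`[n]` and `δ : [n] → ℕ` has min `0` on each block, each `(B_k, δ)` being `A`-connected. -/
def PPset (n : ℕ) (A : Set (Set (Fin n → ℝ))) :
    Set ((Set (Set (Fin n))) × (Fin n → ℕ)) :=
  {p | Setoid.IsPartition p.1 ∧ ∀ B ∈ p.1,
    sInf {c : ℕ | ∃ i ∈ B, p.2 i = c} = 0 ∧ PairConnected n A B p.2}

/-- The map `Λ : L(A) → P(A)`, `Λ(L) = (blocks(L), δ_L)`. -/
noncomputable def Lam (n : ℕ) (L : Set (Fin n → ℝ)) :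
    (Set (Set (Fin n))) × (Fin n → ℕ) :=
  (blocksL n L, deltaL n L)

/-- The map `Δ : P(A) → L(A)`,
`Δ({B_1,…,B_d}, δ) = ⋂_k ⋂_{(i,j,s) ∈ Tr_m^n(A), i,j ∈ B_k, s = δ(i) - δ(j)} {x_i - x_j = s}`. -/
def Delt (m n : ℕ) (A : Set (Set (Fin n → ℝ)))
    (p : (Set (Set (Fin n))) × (Fin n → ℕ)) : Set (Fin n → ℝ) :=
  {x | ∀ B ∈ p.1, ∀ i ∈ B, ∀ j ∈ B, ∀ s : ℕ, TrIdxA m n A i j s →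
    (s : ℤ) = (p.2 i : ℤ) - (p.2 j : ℤ) → x i - x j = (s : ℝ)}

theorem hyp_symm' (n : ℕ) (i j : Fin n) (s : ℝ) : hyp n i j s = hyp n j i (-s) := by
  ext x
  simp only [hyp, Set.mem_setOf_eq]
  constructor <;> intro h <;> linarith

theorem hyp_cat {m n : ℕ} {i j : Fin n} {c : ℝ} (h : hyp n i j c ∈ catArr m n) :
    i ≠ j ∧ |c| ≤ m := by
  obtain ⟨a, b, s, hab, hs, he⟩ := h
  have hs' : |(s : ℝ)| ≤ m := by
    have h1 : s.natAbs ≤ m := hs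
    have h2 : |s| ≤ (m : ℤ) := by rw [Int.abs_eq_natAbs]; exact_mod_cast h1
    exact_mod_cast h2
  have key : ∀ x : Fin n → ℝ, x i - x j = c ↔ x a - x b = s := fun x => by
    have := Set.ext_iff.1 he x
    simpa [hyp] using this
  have h0 := key (Pi.single a (s : ℝ))
  have h1 := key (Pi.single a ((s : ℝ) + 1))
  simp only [Pi.single_apply, hab.ne', if_true, if_false, sub_zero, iff_true] at h0 h1
  have hij : i ≠ j := by
    rintro rfl
    simp only [sub_self] at h0 h1
    have := h1.1 h0
    linarith
  refine ⟨hij, ?_⟩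
  rw [← h0]
  have : (0 : ℝ) ≤ m := Nat.cast_nonneg m
  clear h0 h1 key he
  split_ifs <;> simp [hs', this]

/-- The explicit affine subspace of a pair. -/
def EE (n : ℕ) (p : (Set (Set (Fin n))) × (Fin n → ℕ)) : Set (Fin n → ℝ) :=
  {x | ∀ B ∈ p.1, ∀ i ∈ B, ∀ j ∈ B, x i - x j = (p.2 i : ℝ) - (p.2 j : ℝ)}

theorem delt_eq {m n : ℕ} {A : Set (Set (Fin n → ℝ))} (hA : A ⊆ catArr m n)
    {p} (hp : p ∈ PPset n A) : Delt m n A p = EE n p := by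
  ext x
  constructor
  · intro hx B hB i hi j hj
    have hc := (hp.2 B hB).2 i hi j hj
    induction hc with
    | refl => simp
    | @tail u v _ huv ih =>
      obtain ⟨hu, hv, hH⟩ := huv
      have ih := ih hu
      obtain ⟨hne, habs⟩ := hyp_cat (hA hH)
      have main : x u - x v = (p.2 u : ℝ) - (p.2 v : ℝ) := by
        rw [abs_le] at habs
        have hle1 : (p.2 u : ℝ) ≤ m + p.2 v := by linarith
        have hle2 : (p.2 v : ℝ) ≤ m + p.2 u := by linarith
        have hle1' : p.2 u ≤ m + p.2 v := by exact_mod_cast hle1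
        have hle2' : p.2 v ≤ m + p.2 u := by exact_mod_cast hle2
        by_cases hc : p.2 v < p.2 u ∨ (p.2 v = p.2 u ∧ v < u)
        · have hle : p.2 v ≤ p.2 u := by omega
          have := hx B hB u hu v hv (p.2 u - p.2 v) ⟨⟨by omega, hne, by omega⟩, by
            rw [Nat.cast_sub hle]; exact hH⟩ (by omega)
          rw [Nat.cast_sub hle] at this
          exact this
        · have hle : p.2 u ≤ p.2 v := by omega
          have := hx B hB v hv u hu (p.2 v - p.2 u) ⟨⟨by omega, hne.symm, by omega⟩, by
            rw [Nat.cast_sub hle, hyp_symm', neg_sub]; exact hH⟩ (by omega)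
          rw [Nat.cast_sub hle] at this
          linarith
      linarith
  · intro hx B hB i hi j hj s _ hs
    rw [hx B hB i hi j hj]
    have : ((s : ℤ) : ℝ) = (((p.2 i : ℤ) - (p.2 j : ℤ) : ℤ) : ℝ) := by rw [hs]
    push_cast at this
    exact this.symm

theorem delt_latt {m n : ℕ} {A : Set (Set (Fin n → ℝ))} (hA : A ⊆ catArr m n)
    {p} (hp : p ∈ PPset n A) : Delt m n A p ∈ latt n A := by
  refine ⟨?_, {H | ∃ B ∈ p.1, ∃ i ∈ B, ∃ j ∈ B, ∃ s : ℕ, TrIdxA m n A i j s ∧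
    (s : ℤ) = (p.2 i : ℤ) - (p.2 j : ℤ) ∧ H = hyp n i j s}, ?_, ?_⟩
  · rw [delt_eq hA hp]
    exact ⟨fun i => p.2 i, fun B _ i _ j _ => rfl⟩
  · rintro H ⟨B, hB, i, hi, j, hj, s, hs, _, rfl⟩
    exact hs.2
  · ext x
    constructor
    · rintro hx H ⟨B, hB, i, hi, j, hj, s, hs, h, rfl⟩
      exact hx B hB i hi j hj s hs h
    · intro hx B hB i hi j hj s hs h
      exact hx _ ⟨B, hB, i, hi, j, hj, s, hs, h, rfl⟩

theorem part_unique {n : ℕ} {P : Set (Set (Fin n))} (hP : Setoid.IsPartition P)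
    {B C : Set (Fin n)} (hB : B ∈ P) (hC : C ∈ P) {i : Fin n} (hi : i ∈ B) (hi' : i ∈ C) :
    B = C := (hP.2 i).unique ⟨hB, hi⟩ ⟨hC, hi'⟩

theorem EE_sub {n : ℕ} {p : (Set (Set (Fin n))) × (Fin n → ℕ)}
    (hP : Setoid.IsPartition p.1) {B : Set (Fin n)} (hB : B ∈ p.1) {i : Fin n} (hi : i ∈ B)
    (j : Fin n) (c : ℝ) :
    EE n p ⊆ hyp n i j c ↔ j ∈ B ∧ c = (p.2 i : ℝ) - (p.2 j : ℝ) := by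
  constructor
  · intro h
    have h1 := h (show (fun i => (p.2 i : ℝ)) ∈ EE n p from fun B _ i _ j _ => rfl)
    have h2 := h (show (fun i => (p.2 i : ℝ) + if i ∈ B then 1 else 0) ∈ EE n p from by
      intro C hC k hk l hl
      by_cases hkB : k ∈ B
      · have := part_unique hP hB hC hkB hk
        subst this
        simp [hk, hl]
      · have hlB : l ∉ B := fun hlB => by
          have := part_unique hP hB hC hlB hl
          subst this
          exact hkB hk
        simp [hkB, hlB])
    simp only [hyp, Set.mem_setOf_eq, hi, if_true] at h1 h2
    refine ⟨?_, h1.symm⟩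
    by_contra hj
    simp only [hj, if_false] at h2
    linarith
  · rintro ⟨hj, rfl⟩ x hx
    exact hx B hB i hi j hj

theorem lam_EE {n : ℕ} {A : Set (Set (Fin n → ℝ))}
    {p} (hp : p ∈ PPset n A) : Lam n (EE n p) = p := by
  have hP := hp.1
  have hcls : ∀ B ∈ p.1, ∀ i ∈ B, {j | simL n (EE n p) i j} = B := by
    intro B hB i hi
    ext j
    constructor
    · rintro ⟨s, hs⟩
      exact ((EE_sub hP hB hi j _).1 hs).1
    · intro hj
      exact ⟨(p.2 i : ℤ) - (p.2 j : ℤ), (EE_sub hP hB hi j _).2 ⟨hj, by push_cast; rfl⟩⟩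
  refine Prod.ext ?_ ?_
  · ext C
    constructor
    · rintro ⟨i, rfl⟩
      obtain ⟨B, ⟨hB, hi⟩, _⟩ := hP.2 i
      rw [hcls B hB i hi]
      exact hB
    · intro hC
      obtain ⟨i, hi⟩ := Setoid.nonempty_of_mem_partition hP hC
      exact ⟨i, (hcls C hC i hi).symm⟩
  · funext i
    obtain ⟨B, ⟨hB, hi⟩, _⟩ := hP.2 i
    have hmin : (0 : ℕ) ∈ {c : ℕ | ∃ i ∈ B, p.2 i = c} := by
      have := Nat.sInf_mem (s := {c : ℕ | ∃ i ∈ B, p.2 i = c}) ⟨_, i, hi, rfl⟩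
      rwa [(hp.2 B hB).1] at this
    obtain ⟨a, ha, ha0⟩ := hmin
    have hg : IsGreatest {c : ℕ | ∃ j : Fin n, EE n p ⊆ hyp n i j (c : ℝ)} (p.2 i) := by
      constructor
      · exact ⟨a, (EE_sub hP hB hi a _).2 ⟨ha, by simp [ha0]⟩⟩
      · rintro c ⟨j, hj⟩
        have := ((EE_sub hP hB hi j _).1 hj).2
        have h2 : (c : ℝ) + p.2 j = p.2 i := by linarith
        have h3 : c + p.2 j = p.2 i := by exact_mod_cast h2
        omega
    exact hg.csSup_eq

theorem latt_EE {m n : ℕ} {A : Set (Set (Fin n → ℝ))} (hA : A ⊆ catArr m n)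
    {L} (hL : L ∈ latt n A) : ∃ p ∈ PPset n A, L = EE n p := by
  obtain ⟨⟨x0, hx0⟩, F, hF, rfl⟩ := hL
  let e : Fin n → Fin n → Prop := fun u v => ∃ s : ℤ, hyp n u v s ∈ F
  have esymm : ∀ u v, e u v → e v u := by
    rintro u v ⟨s, hs⟩
    refine ⟨-s, ?_⟩
    rw [hyp_symm']
    simpa using hs
  let r : Setoid (Fin n) := ⟨Relation.ReflTransGen e, fun _ => .refl,
    fun h => (@Relation.ReflTransGen.stdSymm _ e ⟨esymm⟩).symm _ _ h, fun h k => h.trans k⟩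
  have hr : ∀ i j, Relation.ReflTransGen e i j → ∃ s : ℤ, ∀ x ∈ ⋂₀ F, x i - x j = s := by
    intro i j h
    induction h with
    | refl => exact ⟨0, by simp⟩
    | @tail u v _ huv ih =>
      obtain ⟨s, hs⟩ := ih
      obtain ⟨t, ht⟩ := huv
      refine ⟨s + t, fun x hx => ?_⟩
      have h1 := hs x hx
      have h2 : x u - x v = t := hx _ ht
      push_cast
      linarith
  have hr' : ∀ i j, r i j → ∀ x ∈ ⋂₀ F, x i - x j = x0 i - x0 j := by
    intro i j h x hx
    obtain ⟨s, hs⟩ := hr i j h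
    rw [hs x hx, hs x0 hx0]
  have hmin : ∀ i, ∃ a, r i a ∧ ∀ k, r i k → x0 a ≤ x0 k := by
    intro i
    obtain ⟨a, ha, h⟩ := Finset.exists_min_image (Finset.univ.filter fun k => r i k) x0
      ⟨i, by simpa using r.refl i⟩
    simp only [Finset.mem_filter, Finset.mem_univ, true_and] at ha h
    exact ⟨a, ha, h⟩
  choose f hf1 hf2 using hmin
  have hfe : ∀ i j, r i j → x0 (f i) = x0 (f j) := fun i j h =>
    le_antisymm (hf2 i _ (r.trans h (hf1 j))) (hf2 j _ (r.trans (r.symm h) (hf1 i)))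
  have hd : ∀ i, ∃ d : ℕ, x0 i - x0 (f i) = d := by
    intro i
    obtain ⟨s, hs⟩ := hr i _ (hf1 i)
    have h1 := hs x0 hx0
    have h2 := hf2 i i (r.refl i)
    have h3 : (0 : ℝ) ≤ s := by linarith
    have h4 : 0 ≤ s := by exact_mod_cast h3
    lift s to ℕ using h4
    exact ⟨s, by simpa using h1⟩
  choose δ hδ using hd
  have hδr : ∀ i j, r i j → (δ i : ℝ) - δ j = x0 i - x0 j := by
    intro i j h
    have := hfe i j h
    rw [← hδ, ← hδ]
    linarith
  refine ⟨(r.classes, δ), ⟨Setoid.isPartition_classes r, ?_⟩, ?_⟩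
  · rintro B ⟨y, rfl⟩
    constructor
    · apply Nat.sInf_eq_zero.2
      left
      refine ⟨f y, r.symm (hf1 y), ?_⟩
      have h1 := hδ (f y)
      have h2 := hfe y (f y) (hf1 y)
      rw [← h2, sub_self] at h1
      exact_mod_cast h1.symm
    · intro i hi j hj
      have hij : Relation.ReflTransGen e i j := r.trans hi (r.symm hj)
      clear hj
      induction hij with
      | refl => exact .refl
      | @tail u v hu huv ih =>
        refine ih.tail ?_
        have huy : r u y := r.trans (r.symm hu) hi
        have huv' : r u v := Relation.ReflTransGen.single huv
        refine ⟨huy, r.trans (r.symm huv') huy, ?_⟩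
        obtain ⟨s, hs⟩ := huv
        have h1 : x0 u - x0 v = s := hx0 _ hs
        show hyp n u v ((δ u : ℝ) - δ v) ∈ A
        rw [hδr u v huv', h1]
        exact hF hs
  · ext x
    constructor
    · rintro hx B ⟨y, rfl⟩ i hi j hj
      have hij : r i j := r.trans hi (r.symm hj)
      exact (hr' i j hij x hx).trans (hδr i j hij).symm
    · intro hx H hH
      obtain ⟨i, j, s, _, _, rfl⟩ := hA (hF hH)
      have hij : r i j := Relation.ReflTransGen.single ⟨s, hH⟩
      have h1 := hx _ (r.mem_classes j) i hij j (r.refl j)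
      have h2 : x0 i - x0 j = s := hx0 _ hH
      show x i - x j = s
      rw [h1, ← h2]
      exact hδr i j hij

/-- Lemma 6.5. For a braid-type arrangement `A ⊆ A_m^n`, the map
`Λ(L) = (blocks(L), δ_L)` is a bijection from the intersection lattice `L(A)` onto `P(A)`,
with inverse `Δ`. -/
theorem intersection_lattice_encoding (m n : ℕ) (hm : 0 < m) (hn : 0 < n)
    (A : Set (Set (Fin n → ℝ))) (hA : A ⊆ catArr m n) :
    Set.BijOn (Lam n) (latt n A) (PPset n A) ∧
    (∀ L ∈ latt n A, Delt m n A (Lam n L) = L) ∧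
    (∀ p ∈ PPset n A, Lam n (Delt m n A p) = p) := by
  have h1 : ∀ p ∈ PPset n A, Lam n (Delt m n A p) = p := fun p hp => by
    rw [delt_eq hA hp, lam_EE hp]
  have h2 : ∀ L ∈ latt n A, Lam n L ∈ PPset n A ∧ Delt m n A (Lam n L) = L := fun L hL => by
    obtain ⟨p, hp, rfl⟩ := latt_EE hA hL
    rw [lam_EE hp]
    exact ⟨hp, delt_eq hA hp⟩
  refine ⟨⟨fun L hL => (h2 L hL).1, fun L hL M hM h => ?_, fun p hp => ?_⟩,
    fun L hL => (h2 L hL).2, h1⟩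
  · rw [← (h2 L hL).2, h, (h2 M hM).2]
  · exact ⟨_, delt_latt hA hp, h1 p hp⟩


end Braid
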